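/- For every real number B with 1 < B < 2, the set of admissible non-null pairs (α,β) whose associated base B_{(α,β)} equals B (that is, for which the least x ∈ [1/2,1) with Σ_{n≥0} α_n·xⁿ = Σ_{n≥0} β_n·xⁿ is 1/B) is infinite. -/

import Mathlib

open scoped Classical

/-- Infinite binary strings. -/
abbrev Omega : Type := ℕ → Bool

/-- The shift operator. -/
def shift (ω : Omega) : Omega := fun n => ω (n + 1)

/-- Strict lexicographic order on `Omega`. -/
def lexLt (σ ω : Omega) : Prop :=
  ∃ k : ℕ, (∀ i, i < k → σ i = ω i) ∧ σ k < ω k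

/-- Non-strict lexicographic order on `Omega`. -/
def lexLe (σ ω : Omega) : Prop := lexLt σ ω ∨ σ = ω

/-- An admissible pair of strings. -/
def Admissible (α β : Omega) : Prop :=
  α 0 = false ∧ α 1 = true ∧ β 0 = true ∧ β 1 = false ∧
  (∀ n : ℕ, ¬ (lexLt α (shift^[n] α) ∧ lexLe (shift^[n] α) β)) ∧
  (∀ n : ℕ, ¬ (lexLe α (shift^[n] β) ∧ lexLt (shift^[n] β) β))

/-- The address space `Ω_{(α,β,−)}`. -/
def OmegaMinus (α β : Omega) : Set Omega :=
  {ω | ∀ n : ℕ, ¬ (lexLt α (shift^[n] ω) ∧ lexLe (shift^[n] ω) β)}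

/-- The address space `Ω_{(α,β,+)}`. -/
def OmegaPlus (α β : Omega) : Set Omega :=
  {ω | ∀ n : ℕ, ¬ (lexLe α (shift^[n] ω) ∧ lexLt (shift^[n] ω) β)}

/-- The address space `Ω_{(α,β)}`. -/
def OmegaUnion (α β : Omega) : Set Omega := OmegaMinus α β ∪ OmegaPlus α β

/-- Length-`n` initial segments of the elements of `Γ`. -/
def initSegs (Γ : Set Omega) (n : ℕ) : Set (Fin n → Bool) :=
  (fun ω (i : Fin n) => ω i) '' Γ

/-- Exponential growth rate `h(Γ)`. -/
noncomputable def growth (Γ : Set Omega) : ℝ :=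
  Filter.limsup (fun n : ℕ => Real.log ((initSegs Γ n).ncard) / (n : ℝ)) Filter.atTop

/-- The projection map `π_x`. -/
noncomputable def proj (x : ℝ) (ω : Omega) : ℝ :=
  (1 - x) * ∑' k : ℕ, (if ω k then (1 : ℝ) else 0) * x ^ k

/-- The equation `Σ α_n x^n = Σ β_n x^n`. -/
def seriesEq (α β : Omega) (x : ℝ) : Prop :=
  (∑' n : ℕ, (if α n then (1 : ℝ) else 0) * x ^ n) =
    (∑' n : ℕ, (if β n then (1 : ℝ) else 0) * x ^ n)

/-- Solutions in `[1/2,1)` of `Σ α_n x^n = Σ β_n x^n`. -/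
def baseSet (α β : Omega) : Set ℝ :=
  {x : ℝ | x ∈ Set.Ico (1/2 : ℝ) 1 ∧ seriesEq α β x}

/-- A decimal: a two-sided binary string vanishing far to the left. -/
def IsDecimal (d : ℤ → Bool) : Prop := ∃ m : ℤ, ∀ j, j < m → d j = false

/-- Strict order on decimals. -/
def decLt (d e : ℤ → Bool) : Prop :=
  ∃ j : ℤ, (∀ i, i < j → d i = e i) ∧ d j < e j

/-- The set `Γ^•` of decimals obtained from strings in `Γ`. -/
def dot (Γ : Set Omega) : Set (ℤ → Bool) :=
  {d | ∃ m : ℤ, ∃ γ ∈ Γ, (∀ j, j < m → d j = false) ∧ ∀ i : ℕ, d (m + i) = γ i}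

/-- Prepend a `0` to a string. -/
def cons0 (ω : Omega) : Omega := fun n => match n with | 0 => false | k + 1 => ω k

/-- The space `Ω⁰_{(α,β,−)}`. -/
def Omega0Minus (α β : Omega) : Set Omega :=
  {ω ∈ OmegaMinus α β | lexLe (cons0 ω) α}

/-- The space `Ω⁰_{(α,β,+)}`. -/
def Omega0Plus (α β : Omega) : Set Omega :=
  {ω ∈ OmegaPlus α β | lexLt (cons0 ω) α}

/-- The address space of decimals `Ω^•_{(α,β,−)}`. -/
def dotMinus (α β : Omega) : Set (ℤ → Bool) := dot (Omega0Minus α β)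

/-- The address space of decimals `Ω^•_{(α,β,+)}`. -/
def dotPlus (α β : Omega) : Set (ℤ → Bool) := dot (Omega0Plus α β)

/-- The address space of decimals `Ω^•_{(α,β)}`. -/
def dotUnion (α β : Omega) : Set (ℤ → Bool) :=
  dot (Omega0Minus α β ∪ Omega0Plus α β)

/-- The radix map `d ↦ Σ_{j ∈ ℤ} d(j)·B^(−j)`. -/
noncomputable def radixVal (B : ℝ) (d : ℤ → Bool) : ℝ :=
  ∑' j : ℤ, (if d j then (1 : ℝ) else 0) * B ^ (-j)

/-- Shift invariance for a set of decimals. -/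
def ShiftInvariantDec (Γ : Set (ℤ → Bool)) : Prop :=
  ∀ d ∈ Γ, ∀ k m : ℤ,
    (fun j : ℤ => if m ≤ j then d (j + k) else false) ∈ Γ

/-- The piecewise affine map of slope `B` whose right branch is used on `R`. -/
noncomputable def branchMap (B : ℝ) (R : Set ℝ) (y : ℝ) : ℝ :=
  if y ∈ R then B * y + 1 - B else B * y

/-- The itinerary of `y` under `branchMap B R`. -/
noncomputable def itinerary (B : ℝ) (R : Set ℝ) (y : ℝ) : Omega :=
  fun n => decide ((branchMap B R)^[n] y ∈ R)

theorem shift_itinerary (B : ℝ) (R : Set ℝ) (y : ℝ) (n : ℕ) :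
    shift^[n] (itinerary B R y) = itinerary B R ((branchMap B R)^[n] y) := by
  induction n generalizing y with
  | zero => rfl
  | succ n ih =>
    rw [Function.iterate_succ_apply, Function.iterate_succ_apply, ← ih]
    rfl

theorem branchMap_mem_Icc {B p : ℝ} {R : Set ℝ} (hB : 1 < B) (hR : Set.Ioi p ⊆ R)
    (hR' : R ⊆ Set.Ici p) (hp : B - 1 ≤ B * p) (hp' : B * p ≤ 1) {y : ℝ}
    (hy : y ∈ Set.Icc (0 : ℝ) 1) : branchMap B R y ∈ Set.Icc (0 : ℝ) 1 := by
  obtain ⟨h0, h1⟩ := hy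
  unfold branchMap
  split_ifs with h
  · have : p ≤ y := hR' h
    constructor <;> nlinarith
  · have : y ≤ p := le_of_not_gt fun h' => h (hR h')
    constructor <;> nlinarith

theorem iterate_branchMap_mem_Icc {B p : ℝ} {R : Set ℝ} (hB : 1 < B) (hR : Set.Ioi p ⊆ R)
    (hR' : R ⊆ Set.Ici p) (hp : B - 1 ≤ B * p) (hp' : B * p ≤ 1) {y : ℝ}
    (hy : y ∈ Set.Icc (0 : ℝ) 1) (n : ℕ) :
    (branchMap B R)^[n] y ∈ Set.Icc (0 : ℝ) 1 :=
  Set.MapsTo.iterate (fun _ h => branchMap_mem_Icc hB hR hR' hp hp' h) n hy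

theorem iterate_sub_iterate {B : ℝ} {R R' : Set ℝ} {y z : ℝ} {n : ℕ}
    (h : ∀ i < n, itinerary B R y i = itinerary B R' z i) :
    (branchMap B R')^[n] z - (branchMap B R)^[n] y = B ^ n * (z - y) := by
  induction n with
  | zero => simp
  | succ n ih =>
    have ih' := ih fun i hi => h i (by omega)
    have hn := h n (by omega)
    simp only [itinerary, decide_eq_decide] at hn
    rw [Function.iterate_succ_apply', Function.iterate_succ_apply', pow_succ]
    have : ∀ u v : ℝ, (u ∈ R ↔ v ∈ R') →
        branchMap B R' v - branchMap B R u = B * (v - u) := by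
      intro u v huv
      unfold branchMap
      by_cases hu : u ∈ R
      · rw [if_pos hu, if_pos (huv.1 hu)]; ring
      · rw [if_neg hu, if_neg fun hv => hu (huv.2 hv)]; ring
    rw [this _ _ hn, ih']
    ring

theorem itinerary_lt_itinerary {B p : ℝ} {R R' : Set ℝ} (hB : 1 < B)
    (hR : Set.Ioi p ⊆ R) (hR' : R ⊆ Set.Ici p) (hS : Set.Ioi p ⊆ R') (hS' : R' ⊆ Set.Ici p)
    (hp : B - 1 ≤ B * p) (hp' : B * p ≤ 1) {y z : ℝ} (hy : y ∈ Set.Icc (0 : ℝ) 1)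
    (hz : z ∈ Set.Icc (0 : ℝ) 1) (hyz : y < z) :
    lexLt (itinerary B R y) (itinerary B R' z) := by
  have hex : ∃ n, itinerary B R y n ≠ itinerary B R' z n := by
    by_contra! hall
    obtain ⟨n, hn⟩ := pow_unbounded_of_one_lt (1 / (z - y)) hB
    have h1 := iterate_sub_iterate (n := n) fun i _ => hall i
    have h2 := iterate_branchMap_mem_Icc hB hR hR' hp hp' hy n
    have h3 := iterate_branchMap_mem_Icc hB hS hS' hp hp' hz n
    rw [div_lt_iff₀ (by linarith)] at hn
    linarith [h2.1, h3.2]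
  have hagree : ∀ i < Nat.find hex, itinerary B R y i = itinerary B R' z i :=
    fun i hi => not_not.1 (Nat.find_min hex hi)
  refine ⟨Nat.find hex, hagree, ?_⟩
  have hne := Nat.find_spec hex
  have hsub := iterate_sub_iterate hagree
  have hpos : 0 < B ^ Nat.find hex * (z - y) :=
    mul_pos (pow_pos (by linarith) _) (by linarith)
  generalize Nat.find hex = n at *
  simp only [itinerary, ne_eq, decide_eq_decide] at hne ⊢
  have himp : (branchMap B R)^[n] y ∈ R → (branchMap B R')^[n] z ∈ R' := by
    intro h
    have h' : p ≤ (branchMap B R)^[n] y := hR' h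
    exact hS (show p < _ by linarith)
  by_cases h : (branchMap B R)^[n] y ∈ R
  · exact absurd ⟨himp, fun _ => h⟩ hne
  · have h' : (branchMap B R')^[n] z ∈ R' := by
      by_contra h'
      exact hne ⟨himp, fun hh => absurd hh h'⟩
    simp [h, h']

theorem lexLt_irrefl (σ : Omega) : ¬ lexLt σ σ := fun ⟨_, _, h⟩ => lt_irrefl _ h

theorem lexLt_asymm {σ ω : Omega} (h : lexLt σ ω) : ¬ lexLt ω σ := by
  rintro ⟨l, hl, hl'⟩
  obtain ⟨k, hk, hk'⟩ := h
  rcases lt_trichotomy k l with hkl | rfl | hkl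
  · rw [hl k hkl] at hk'
    exact lt_irrefl _ hk'
  · exact lt_asymm hk' hl'
  · rw [hk l hkl] at hl'
    exact lt_irrefl _ hl'

theorem lexLt_not_lexLe {σ ω : Omega} (h : lexLt σ ω) : ¬ lexLe ω σ := by
  rintro (h' | rfl)
  · exact lexLt_asymm h h'
  · exact lexLt_irrefl _ h

theorem itinerary_mem_OmegaMinus {B p : ℝ} (hB : 1 < B) (hp : B - 1 ≤ B * p)
    (hp' : B * p ≤ 1) (hpI : p ∈ Set.Icc (0 : ℝ) 1) {y : ℝ} (hy : y ∈ Set.Icc (0 : ℝ) 1) :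
    itinerary B (Set.Ioi p) y ∈
      OmegaMinus (itinerary B (Set.Ioi p) p) (itinerary B (Set.Ici p) p) := by
  intro n
  have hyn := iterate_branchMap_mem_Icc hB subset_rfl Set.Ioi_subset_Ici_self hp hp' hy n
  rw [shift_itinerary]
  generalize (branchMap B (Set.Ioi p))^[n] y = u at *
  rintro ⟨h1, h2⟩
  rcases lt_trichotomy u p with h | rfl | h
  · exact lexLt_asymm h1 (itinerary_lt_itinerary hB subset_rfl Set.Ioi_subset_Ici_self
      subset_rfl Set.Ioi_subset_Ici_self hp hp' hyn hpI h)
  · exact lexLt_irrefl _ h1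
  · exact lexLt_not_lexLe (itinerary_lt_itinerary hB Set.Ioi_subset_Ici_self subset_rfl
      subset_rfl Set.Ioi_subset_Ici_self hp hp' hpI hyn h) h2

theorem itinerary_mem_OmegaPlus {B p : ℝ} (hB : 1 < B) (hp : B - 1 ≤ B * p)
    (hp' : B * p ≤ 1) (hpI : p ∈ Set.Icc (0 : ℝ) 1) {y : ℝ} (hy : y ∈ Set.Icc (0 : ℝ) 1) :
    itinerary B (Set.Ici p) y ∈
      OmegaPlus (itinerary B (Set.Ioi p) p) (itinerary B (Set.Ici p) p) := by
  intro n
  have hyn := iterate_branchMap_mem_Icc hB Set.Ioi_subset_Ici_self subset_rfl hp hp' hy n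
  rw [shift_itinerary]
  generalize (branchMap B (Set.Ici p))^[n] y = u at *
  rintro ⟨h1, h2⟩
  rcases lt_trichotomy u p with h | rfl | h
  · exact lexLt_not_lexLe (itinerary_lt_itinerary hB Set.Ioi_subset_Ici_self subset_rfl
      subset_rfl Set.Ioi_subset_Ici_self hp hp' hyn hpI h) h1
  · exact lexLt_irrefl _ h2
  · exact lexLt_asymm h2 (itinerary_lt_itinerary hB Set.Ioi_subset_Ici_self subset_rfl
      Set.Ioi_subset_Ici_self subset_rfl hp hp' hpI hyn h)

theorem admissible_itinerary {B p : ℝ} (hB : 1 < B) (hp : B - 1 ≤ B * p)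
    (hp' : B * p ≤ 1) (h0 : 0 < p) (h1 : p < 1) :
    Admissible (itinerary B (Set.Ioi p) p) (itinerary B (Set.Ici p) p) := by
  refine ⟨?_, ?_, ?_, ?_, itinerary_mem_OmegaMinus hB hp hp' ⟨h0.le, h1.le⟩ ⟨h0.le, h1.le⟩,
    itinerary_mem_OmegaPlus hB hp hp' ⟨h0.le, h1.le⟩ ⟨h0.le, h1.le⟩⟩
  · simp [itinerary]
  · simp only [itinerary, branchMap, Function.iterate_one, Set.mem_Ioi, lt_irrefl, if_false,
      decide_eq_true_eq]
    nlinarith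
  · simp [itinerary]
  · simp only [itinerary, branchMap, Function.iterate_one, Set.mem_Ici, le_refl, if_true,
      decide_eq_false_iff_not, not_le]
    nlinarith

theorem hasSum_itinerary {B p : ℝ} {R : Set ℝ} (hB : 1 < B) (hR : Set.Ioi p ⊆ R)
    (hR' : R ⊆ Set.Ici p) (hp : B - 1 ≤ B * p) (hp' : B * p ≤ 1) {y : ℝ}
    (hy : y ∈ Set.Icc (0 : ℝ) 1) :
    HasSum (fun n => (if itinerary B R y n then (1 : ℝ) else 0) * (1 / B) ^ n)
      (B / (B - 1) * y) := by
  have hB0 : B ≠ 0 := by linarith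
  have hB1 : B - 1 ≠ 0 := by linarith
  rw [hasSum_iff_tendsto_nat_of_nonneg (fun n => by positivity)]
  have hpart : ∀ n, ∑ i ∈ Finset.range n,
      (if itinerary B R y i then (1 : ℝ) else 0) * (1 / B) ^ i =
      B / (B - 1) * y - B / (B - 1) * ((1 / B) ^ n * (branchMap B R)^[n] y) := by
    intro n
    induction n with
    | zero => simp
    | succ n ih =>
      rw [Finset.sum_range_succ, ih, Function.iterate_succ_apply', pow_succ]
      simp only [itinerary, branchMap, decide_eq_true_eq]
      split_ifs <;> field_simp <;> ring
  simp_rw [hpart]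
  have hlim : Filter.Tendsto (fun n => (1 / B) ^ n * (branchMap B R)^[n] y) Filter.atTop
      (nhds 0) := by
    refine squeeze_zero (fun n => ?_) (fun n => ?_)
      (tendsto_pow_atTop_nhds_zero_of_lt_one (r := 1 / B) (by positivity)
        (by rw [div_lt_one (by linarith)]; exact hB))
    · exact mul_nonneg (by positivity)
        (iterate_branchMap_mem_Icc hB hR hR' hp hp' hy n).1
    · exact mul_le_of_le_one_right (by positivity)
        (iterate_branchMap_mem_Icc hB hR hR' hp hp' hy n).2
  simpa using (hlim.const_mul (B / (B - 1))).const_sub (B / (B - 1) * y)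

theorem pow_le_ncard_initSegs {B p : ℝ} (hB : 1 < B) (hp : B - 1 ≤ B * p)
    (hp' : B * p ≤ 1) (hpI : p ∈ Set.Icc (0 : ℝ) 1) (n : ℕ) :
    B ^ n ≤ (initSegs (OmegaUnion (itinerary B (Set.Ioi p) p)
      (itinerary B (Set.Ici p) p)) n).ncard := by
  have hBn : 0 < B ^ n := pow_pos (by linarith) n
  obtain ⟨M, hM⟩ : ∃ M, ⌈B ^ n⌉₊ = M + 1 :=
    Nat.exists_eq_add_one.2 (Nat.ceil_pos.2 hBn)
  have hMlt : (M : ℝ) < B ^ n := Nat.lt_ceil.1 (by omega)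
  have hpt : ∀ j < M + 1, (j : ℝ) / M ∈ Set.Icc (0 : ℝ) 1 := fun j hj =>
    ⟨by positivity, div_le_one_of_le₀ (by exact_mod_cast Nat.lt_succ_iff.1 hj) (by positivity)⟩
  let w : ℕ → (Fin n → Bool) := fun j i => itinerary B (Set.Ioi p) ((j : ℝ) / M) i
  have key : ∀ j < M + 1, ∀ k < M + 1, j < k → w j ≠ w k := by
    intro j hj k hk hjk hw
    have hM0 : (0 : ℝ) < M := by exact_mod_cast (by omega : 0 < M)
    have h1 := iterate_sub_iterate (B := B) (R := Set.Ioi p) (R' := Set.Ioi p)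
      (y := (j : ℝ) / M) (z := (k : ℝ) / M) (n := n) fun i hi => congrFun hw ⟨i, hi⟩
    have h2 := iterate_branchMap_mem_Icc hB subset_rfl Set.Ioi_subset_Ici_self hp hp' (hpt j hj) n
    have h3 := iterate_branchMap_mem_Icc hB subset_rfl Set.Ioi_subset_Ici_self hp hp' (hpt k hk) n
    have h4 : B ^ n * ((k : ℝ) / M - j / M) ≤ 1 := by linarith [h2.1, h3.2]
    have h5 : (1 : ℝ) ≤ k - j := by
      have : (j : ℝ) + 1 ≤ k := by exact_mod_cast hjk
      linarith
    rw [← sub_div, mul_div_assoc', div_le_one hM0] at h4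
    nlinarith
  have hinj : Set.InjOn w (Finset.range (M + 1)) := by
    intro j hj k hk hw
    simp only [Finset.coe_range, Set.mem_Iio] at hj hk
    rcases lt_trichotomy j k with h | h | h
    · exact absurd hw (key j hj k hk h)
    · exact h
    · exact absurd hw.symm (key k hk j hj h)
  have hsub : w '' (Finset.range (M + 1) : Set ℕ) ⊆
      initSegs (OmegaUnion (itinerary B (Set.Ioi p) p) (itinerary B (Set.Ici p) p)) n := by
    rintro _ ⟨j, hj, rfl⟩
    simp only [Finset.coe_range, Set.mem_Iio] at hj
    exact ⟨_, Or.inl (itinerary_mem_OmegaMinus hB hp hp' hpI (hpt j hj)), rfl⟩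
  have hcard := Set.ncard_le_ncard hsub (Set.toFinite _)
  rw [hinj.ncard_image, Set.ncard_coe_finset, Finset.card_range, ← hM] at hcard
  exact (Nat.le_ceil _).trans (by exact_mod_cast hcard)

theorem ncard_initSegs_le (Γ : Set Omega) (n : ℕ) : (initSegs Γ n).ncard ≤ 2 ^ n := by
  have h := Set.ncard_le_ncard (Set.subset_univ (initSegs Γ n)) (Set.toFinite _)
  simpa [Set.ncard_univ, Nat.card_eq_fintype_card] using h

theorem log_le_growth {Γ : Set Omega} {B : ℝ} (hB : 1 < B)
    (h : ∀ n, B ^ n ≤ (initSegs Γ n).ncard) : Real.log B ≤ growth Γ := by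
  have hpos : ∀ n, (0 : ℝ) < (initSegs Γ n).ncard := fun n =>
    (pow_pos (by linarith) n).trans_le (h n)
  refine Filter.le_limsup_of_frequently_le ?_ ?_
  · refine Filter.Eventually.frequently ?_
    filter_upwards [Filter.eventually_gt_atTop 0] with n hn
    rw [le_div_iff₀ (by exact_mod_cast hn), mul_comm, ← Real.log_pow]
    exact Real.log_le_log (pow_pos (by linarith) n) (h n)
  · refine Filter.isBoundedUnder_of_eventually_le (a := Real.log 2) ?_
    filter_upwards [Filter.eventually_gt_atTop 0] with n hn
    rw [div_le_iff₀ (by exact_mod_cast hn), mul_comm, ← Real.log_pow]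
    exact Real.log_le_log (hpos n) (by exact_mod_cast ncard_initSegs_le Γ n)

theorem pow_sub_pow_le {x c : ℝ} (hx : 0 ≤ x) (hxc : x ≤ c) (n : ℕ) :
    c ^ n - x ^ n ≤ n * c ^ (n - 1) * (c - x) := by
  have hc : 0 ≤ c := hx.trans hxc
  induction n with
  | zero => simp
  | succ n ih =>
    have h1 : x ^ n ≤ c ^ n := pow_le_pow_left₀ hx hxc n
    have h2 : c * (n * c ^ (n - 1)) = n * c ^ n := by
      rcases n with _ | n
      · simp
      · rw [Nat.add_sub_cancel, pow_succ]; ring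
    have h3 := mul_le_mul_of_nonneg_left ih hc
    have h4 := mul_le_mul_of_nonneg_right h1 (sub_nonneg.2 hxc)
    rw [Nat.add_sub_cancel, pow_succ, pow_succ]
    push_cast
    nlinarith

theorem summable_digits (ω : Omega) {x : ℝ} (hx : 0 ≤ x) (hx1 : x < 1) :
    Summable fun n => (if ω n then (1 : ℝ) else 0) * x ^ n := by
  refine Summable.of_nonneg_of_le (fun n => by positivity) (fun n => ?_)
    (summable_geometric_of_lt_one hx hx1)
  exact mul_le_of_le_one_left (by positivity) (by split_ifs <;> norm_num)

/-- If `β` has a long block of zeros after its first digit, then `Σ α_n xⁿ = Σ β_n xⁿ` has at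
most one solution in an initial interval. -/
theorem seriesEq_le {α β : Omega} {c x : ℝ} {k : ℕ} (hc : c < 1) (hx : 0 ≤ x)
    (hα : α 1 = true) (hβ : ∀ n, 1 ≤ n → n < k → β n = false)
    (hs : Summable fun n : ℕ => (n : ℝ) * c ^ (n - 1))
    (hk : ∑' n : ℕ, ((n + k : ℕ) : ℝ) * c ^ (n + k - 1) < 1)
    (hcE : seriesEq α β c) (hxE : seriesEq α β x) : c ≤ x := by
  by_contra! hxc
  have hc0 : 0 ≤ c := hx.trans hxc.le
  have hx1 : x < 1 := hxc.trans hc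
  have hsub : ∀ n, 0 ≤ c ^ n - x ^ n := fun n => sub_nonneg.2 (pow_le_pow_left₀ hx hxc.le n)
  have hdiff : ∀ ω : Omega, HasSum
      (fun n => (if ω n then (1 : ℝ) else 0) * (c ^ n - x ^ n))
      ((∑' n, (if ω n then (1 : ℝ) else 0) * c ^ n) -
        ∑' n, (if ω n then (1 : ℝ) else 0) * x ^ n) := by
    intro ω
    simpa only [mul_sub] using
      (summable_digits ω hc0 hc).hasSum.sub (summable_digits ω hx hx1).hasSum
  have hα' := hdiff α
  have hβ' := hdiff β
  unfold seriesEq at hcE hxE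
  rw [hcE, hxE] at hα'
  have hlow := le_hasSum hα' 1 fun n _ => mul_nonneg (by positivity) (hsub n)
  simp only [hα, if_true, one_mul, pow_one] at hlow
  have htail := ((hasSum_nat_add_iff' k).2 hβ')
  have hzero : ∑ n ∈ Finset.range k, (if β n then (1 : ℝ) else 0) * (c ^ n - x ^ n) = 0 := by
    refine Finset.sum_eq_zero fun n hn => ?_
    rcases n with _ | n
    · simp
    · rw [hβ (n + 1) (by omega) (Finset.mem_range.1 hn)]
      simp
  rw [hzero, sub_zero] at htail
  have hup := hasSum_le (fun n => ?_) htail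
    ((((summable_nat_add_iff k).2 hs).hasSum).mul_right (c - x))
  · have := mul_lt_mul_of_pos_right hk (sub_pos.2 hxc)
    linarith
  · exact (mul_le_of_le_one_left (hsub _) (by split_ifs <;> norm_num)).trans
      (pow_sub_pow_le hx hxc.le _)

theorem iterate_branchMap_Ici {B p : ℝ} (hB : 1 < B) (hp : B - 1 < B * p) {k n : ℕ}
    (hk : B ^ k * (p - (1 - 1 / B)) < p) (h1 : 1 ≤ n) (hn : n ≤ k) :
    (branchMap B (Set.Ici p))^[n] p = B ^ n * (p - (1 - 1 / B)) := by
  have hB0 : B ≠ 0 := by linarith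
  have hpos : 0 < p - (1 - 1 / B) := by
    have : 0 < B * (p - (1 - 1 / B)) := by field_simp; linarith
    exact pos_of_mul_pos_right this (by linarith)
  induction n, h1 using Nat.le_induction with
  | base =>
    simp only [Function.iterate_one, branchMap, Set.mem_Ici, le_refl, if_true]
    field_simp
    ring
  | succ n h1 ih =>
    rw [Function.iterate_succ_apply', ih (by omega)]
    have : B ^ n * (p - (1 - 1 / B)) ≤ B ^ k * (p - (1 - 1 / B)) :=
      mul_le_mul_of_nonneg_right (pow_le_pow_right₀ hB.le (by omega)) hpos.le
    rw [branchMap, if_neg (Set.notMem_Ici.2 (this.trans_lt hk)), pow_succ]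
    ring

/-- For every `1 < B < 2` there are infinitely many admissible non-null
pairs `(α,β)` whose associated base `B_{(α,β)}` equals `B`, i.e. for which the least
solution in `[1/2,1)` of `Σ α_n x^n = Σ β_n x^n` is `1/B`. -/
theorem stmt_12 (B : ℝ) (hB1 : 1 < B) (hB2 : B < 2) :
    {q : Omega × Omega | Admissible q.1 q.2 ∧ growth (OmegaUnion q.1 q.2) ≠ 0 ∧
      IsLeast (baseSet q.1 q.2) (1 / B)}.Infinite := by
  have hB0 : 0 < B := by linarith
  have hc0 : 0 < 1 / B := by positivity
  have hc1 : 1 / B < 1 := (div_lt_one hB0).2 hB1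
  have hc2 : 1 / 2 < 1 / B := one_div_lt_one_div_of_lt hB0 hB2
  have hs : Summable fun n : ℕ => (n : ℝ) * (1 / B) ^ (n - 1) := by
    refine (summable_nat_add_iff 1).1 ?_
    have h1 := summable_pow_mul_geometric_of_norm_lt_one 1 (r := 1 / B)
      (by rwa [Real.norm_of_nonneg hc0.le])
    have h2 := h1.add (summable_geometric_of_lt_one hc0.le hc1)
    refine h2.congr fun n => ?_
    rw [Nat.add_sub_cancel]
    push_cast
    ring
  obtain ⟨k, hk⟩ := ((tendsto_sum_nat_add fun n : ℕ => (n : ℝ) * (1 / B) ^ (n - 1)).eventually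
    (gt_mem_nhds one_pos)).exists
  have hδ : 0 < min ((1 - 1 / B) / B ^ k) (1 / B - (1 - 1 / B)) :=
    lt_min (div_pos (by linarith) (pow_pos hB0 k)) (by linarith)
  have hBc : B * (1 / B) = 1 := mul_one_div_cancel hB0.ne'
  have hrange : ∀ p ∈ Set.Ioo (1 - 1 / B)
      (1 - 1 / B + min ((1 - 1 / B) / B ^ k) (1 / B - (1 - 1 / B))),
      B - 1 < B * p ∧ B * p ≤ 1 ∧ 0 < p ∧ p < 1 := by
    rintro p ⟨h1, h2⟩
    have h3 := min_le_right ((1 - 1 / B) / B ^ k) (1 / B - (1 - 1 / B))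
    have h4 := mul_lt_mul_of_pos_left h1 hB0
    have h5 : B * p ≤ B * (1 / B) := mul_le_mul_of_nonneg_left (by linarith) hB0.le
    refine ⟨by linarith, by linarith, by linarith, by linarith⟩
  refine Set.infinite_of_injOn_mapsTo
    (f := fun p => (itinerary B (Set.Ioi p) p, itinerary B (Set.Ici p) p))
    (s := Set.Ioo (1 - 1 / B) (1 - 1 / B + min ((1 - 1 / B) / B ^ k) (1 / B - (1 - 1 / B))))
    ?_ ?_ (Set.Ioo_infinite (by linarith))
  · intro p hp q hq hpq
    obtain ⟨p1, p2, p3, p4⟩ := hrange p hp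
    obtain ⟨q1, q2, q3, q4⟩ := hrange q hq
    have hP := hasSum_itinerary hB1 subset_rfl Set.Ioi_subset_Ici_self p1.le p2 ⟨p3.le, p4.le⟩
    have hQ := hasSum_itinerary hB1 subset_rfl Set.Ioi_subset_Ici_self q1.le q2 ⟨q3.le, q4.le⟩
    rw [show itinerary B (Set.Ioi p) p = itinerary B (Set.Ioi q) q from congrArg Prod.fst hpq] at hP
    exact mul_left_cancel₀ (div_ne_zero hB0.ne' (by linarith)) (hP.unique hQ)
  · intro p hp
    obtain ⟨p1, p2, p3, p4⟩ := hrange p hp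
    have hpI : p ∈ Set.Icc (0 : ℝ) 1 := ⟨p3.le, p4.le⟩
    have hadm := admissible_itinerary hB1 p1.le p2 p3 p4
    have heq : seriesEq (itinerary B (Set.Ioi p) p) (itinerary B (Set.Ici p) p) (1 / B) :=
      (hasSum_itinerary hB1 subset_rfl Set.Ioi_subset_Ici_self p1.le p2 hpI).tsum_eq.trans
        (hasSum_itinerary hB1 Set.Ioi_subset_Ici_self subset_rfl p1.le p2 hpI).tsum_eq.symm
    have hsmall : B ^ k * (p - (1 - 1 / B)) < p := by
      have h1 := min_le_left ((1 - 1 / B) / B ^ k) (1 / B - (1 - 1 / B))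
      have h2 : p - (1 - 1 / B) < (1 - 1 / B) / B ^ k := by linarith [hp.2]
      rw [lt_div_iff₀ (pow_pos hB0 k), mul_comm] at h2
      exact h2.trans hp.1
    refine ⟨hadm, ?_, ⟨⟨hc2.le, hc1⟩, heq⟩, ?_⟩
    · exact ((Real.log_pos hB1).trans_le
        (log_le_growth hB1 (pow_le_ncard_initSegs hB1 p1.le p2 hpI))).ne'
    · rintro x ⟨⟨hx, -⟩, hxE⟩
      refine seriesEq_le hc1 (by linarith) hadm.2.1 (fun n h1 hn => ?_) hs hk heq hxE
      have hle : B ^ n * (p - (1 - 1 / B)) ≤ B ^ k * (p - (1 - 1 / B)) :=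
        mul_le_mul_of_nonneg_right (pow_le_pow_right₀ hB1.le hn.le) (by linarith [hp.1])
      simp only [itinerary, iterate_branchMap_Ici hB1 p1 hsmall h1 hn.le, Set.mem_Ici,
        decide_eq_false_iff_not, not_le]
      exact hle.trans_lt hsmall
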